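/- Let ψ ∈ ℂ^d ⊗ ℂ^d ⊗ ℂ^m be a unit vector satisfying (Z_d ⊗ Z_d† ⊗ 𝟙_m) ψ = ψ and ( [∑_{k=1}^{d-1} ( γ(α)·X_d^k ⊗ X_d^k + δ_k(α)·Z_d^k ⊗ 𝟙_d )] ⊗ 𝟙_m ) ψ = ψ. Then there exists a unit vector ξ ∈ ℂ^m such that ψ = |ψ(α)⟩ ⊗ ξ, i.e. the components of ψ satisfy ψ_{a,b,e} = α_a·δ_{ab}·ξ_e for all a, b ∈ {0,…,d−1} and all e. -/

import Mathlib

open Matrix Kronecker Finset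
open scoped ComplexOrder

noncomputable section

/-- `ω = exp(2πi/d)`. -/
def om (d : ℕ) : ℂ := Complex.exp (2 * Real.pi * Complex.I / d)

/-- The generalized Pauli matrix `Z_d = ∑_i ω^i |i⟩⟨i|`. -/
def Zd (d : ℕ) : Matrix (Fin d) (Fin d) ℂ :=
  Matrix.diagonal fun i => om d ^ (i : ℕ)

/-- The generalized Pauli matrix `X_d = ∑_i |i+1 mod d⟩⟨i|`. -/
def Xd (d : ℕ) : Matrix (Fin d) (Fin d) ℂ :=
  Matrix.of fun i j => if (i : ℕ) = ((j : ℕ) + 1) % d then 1 else 0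

/-- `γ(α) = d / ∑_{i≠j} α_i/α_j` (sum over ordered pairs `i ≠ j`). -/
def gam (d : ℕ) (α : Fin d → ℝ) : ℝ :=
  d / ∑ i : Fin d, ∑ j : Fin d, if i ≠ j then α i / α j else 0

/-- `δ_k(α) = -(γ(α)/d) ∑_{i≠j} (α_i/α_j) ω^{k(d-j)}`. -/
def delt (d : ℕ) (α : Fin d → ℝ) (k : ℕ) : ℂ :=
  -(((gam d α : ℝ) : ℂ) / d) * ∑ i : Fin d, ∑ j : Fin d,
    if i ≠ j then ((α i / α j : ℝ) : ℂ) * om d ^ (k * (d - (j : ℕ))) else 0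


theorem om_prim (d : ℕ) [NeZero d] : IsPrimitiveRoot (om d) d :=
  Complex.isPrimitiveRoot_exp d (NeZero.ne d)

theorem Xd_pow (d : ℕ) [NeZero d] (k : ℕ) (i j : Fin d) :
    (Xd d ^ k) i j = if (i : ℕ) = ((j : ℕ) + k) % d then 1 else 0 := by
  induction k generalizing i with
  | zero =>
    simp [Matrix.one_apply, Nat.mod_eq_of_lt j.2, Fin.ext_iff]
  | succ k ih =>
    rw [pow_succ', Matrix.mul_apply]
    have hlt : ((j : ℕ) + k) % d < d := Nat.mod_lt _ (Nat.pos_of_ne_zero (NeZero.ne d))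
    rw [Finset.sum_eq_single (⟨((j : ℕ) + k) % d, hlt⟩ : Fin d)]
    · rw [ih]
      simp [Xd, add_assoc]
    · intro b _ hb
      rw [ih, if_neg, mul_zero]
      intro h
      exact hb (Fin.ext h)
    · simp

theorem sum_X (d : ℕ) [NeZero d] (a c : Fin d) :
    ∑ k ∈ Finset.Ico 1 d, (Xd d ^ k) a c * (Xd d ^ k) a c = if a = c then 0 else 1 := by
  have ha := a.2
  have hc := c.2
  simp only [Xd_pow, mul_ite, mul_one, mul_zero]
  split_ifs with h
  · subst h
    apply Finset.sum_eq_zero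
    intro k hk
    rw [Finset.mem_Ico] at hk
    have : ¬ ((a : ℕ) = (a + k) % d) := by
      intro h
      rcases lt_or_ge ((a : ℕ) + k) d with h1 | h1
      · rw [Nat.mod_eq_of_lt h1] at h; omega
      · rw [Nat.mod_eq_sub_mod h1, Nat.mod_eq_of_lt (by omega)] at h; omega
    simp [this]
  · have hne : (a : ℕ) ≠ c := fun h' => h (Fin.ext h')
    rw [Finset.sum_eq_single (if (c : ℕ) < a then (a : ℕ) - c else a + d - c)]
    · have : (a : ℕ) = (c + (if (c : ℕ) < a then (a : ℕ) - c else a + d - c)) % d := by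
        split_ifs with h1
        · rw [Nat.mod_eq_of_lt (by omega)]; omega
        · rw [show (c : ℕ) + (a + d - c) = a + d by omega, Nat.add_mod_right,
            Nat.mod_eq_of_lt ha]
      rw [← this]; simp
    · intro k hk hkne
      rw [Finset.mem_Ico] at hk
      have : ¬ ((a : ℕ) = (c + k) % d) := by
        intro h
        rcases lt_or_ge ((c : ℕ) + k) d with h1 | h1
        · rw [Nat.mod_eq_of_lt h1] at h; split_ifs at hkne <;> omega
        · rw [Nat.mod_eq_sub_mod h1, Nat.mod_eq_of_lt (by omega)] at h
          split_ifs at hkne <;> omega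
      simp [this]
    · intro h2
      exfalso
      apply h2
      rw [Finset.mem_Ico]
      split_ifs <;> omega

theorem sum_om (d : ℕ) [NeZero d] (a j : Fin d) :
    ∑ k ∈ Finset.Ico 1 d, om d ^ (k * (d - (j : ℕ))) * om d ^ (k * (a : ℕ))
      = (if j = a then (d : ℂ) else 0) - 1 := by
  have hp := om_prim d
  have ha := a.2
  have hj := j.2
  have h0 : ∑ k ∈ Finset.range d, (om d ^ (d - (j : ℕ) + a)) ^ k
      = if j = a then (d : ℂ) else 0 := by
    split_ifs with h
    · subst h
      rw [show d - (j : ℕ) + j = d by omega, hp.pow_eq_one]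
      simp
    · have hne : (a : ℕ) ≠ j := fun h' => h (Fin.ext h'.symm)
      have h1 : om d ^ (d - (j : ℕ) + a) ≠ 1 := by
        intro h1
        rw [hp.pow_eq_one_iff_dvd] at h1
        obtain ⟨q, hq⟩ := h1
        rcases q with _ | _ | q
        · omega
        · omega
        · have : d * (q + 1 + 1) = d * q + d + d := by ring
          have := Nat.zero_le (d * q)
          omega
      rw [geom_sum_eq h1, ← pow_mul, mul_comm, pow_mul, hp.pow_eq_one]
      simp
  rw [← h0, Finset.range_eq_Ico, Finset.sum_eq_sum_Ico_succ_bot (by omega : 0 < d)]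
  simp only [pow_zero, zero_add, add_sub_cancel_left]
  apply Finset.sum_congr rfl
  intro k _
  rw [← pow_add, ← pow_mul]
  congr 1
  ring

theorem S_pos (d : ℕ) [NeZero d] (hd : 2 ≤ d) (α : Fin d → ℝ) (hpos : ∀ i, 0 < α i) :
    0 < ∑ i : Fin d, ∑ j : Fin d, if i ≠ j then α i / α j else 0 := by
  have hnn : ∀ i j : Fin d, 0 ≤ if i ≠ j then α i / α j else 0 := by
    intro i j
    split_ifs
    · exact (div_pos (hpos i) (hpos j)).le
    · exact le_rfl
  apply Finset.sum_pos' (fun i _ => Finset.sum_nonneg fun j _ => hnn i j)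
  refine ⟨⟨0, by omega⟩, Finset.mem_univ _, ?_⟩
  apply Finset.sum_pos' (fun j _ => hnn _ j)
  refine ⟨⟨1, by omega⟩, Finset.mem_univ _, ?_⟩
  rw [if_pos (by simp)]
  exact div_pos (hpos _) (hpos _)

theorem sum_delt (d : ℕ) [NeZero d] (hd : 2 ≤ d) (α : Fin d → ℝ) (hpos : ∀ i, 0 < α i)
    (a : Fin d) :
    ∑ k ∈ Finset.Ico 1 d, delt d α k * om d ^ (k * (a : ℕ))
      = 1 - (gam d α : ℂ) * ((∑ i, (α i : ℂ)) / α a - 1) := by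
  have hd0 : (d : ℂ) ≠ 0 := by exact_mod_cast NeZero.ne d
  have hS := S_pos d hd α hpos
  have hgS : (gam d α : ℂ) * (∑ i : Fin d, ∑ j : Fin d,
      if i ≠ j then ((α i / α j : ℝ) : ℂ) else 0) = d := by
    have : gam d α * (∑ i : Fin d, ∑ j : Fin d, if i ≠ j then α i / α j else 0) = d := by
      unfold gam
      field_simp
    have h2 := congrArg (fun x : ℝ => (x : ℂ)) this
    simp only [Complex.ofReal_mul, Complex.ofReal_sum, Complex.ofReal_natCast] at h2
    rw [← h2]
    congr 1
    refine Finset.sum_congr rfl fun i _ => Finset.sum_congr rfl fun j _ => ?_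
    split_ifs <;> simp
  have h1 : ∑ k ∈ Finset.Ico 1 d, delt d α k * om d ^ (k * (a : ℕ))
      = -((gam d α : ℂ) / d) * ∑ i : Fin d, ∑ j : Fin d,
        (if i ≠ j then ((α i / α j : ℝ) : ℂ) else 0) * ((if j = a then (d : ℂ) else 0) - 1) := by
    simp only [delt, mul_assoc, ← Finset.mul_sum]
    congr 1
    simp only [Finset.sum_mul]
    rw [Finset.sum_comm]
    refine Finset.sum_congr rfl fun i _ => ?_
    rw [Finset.sum_comm]
    refine Finset.sum_congr rfl fun j _ => ?_
    rw [← sum_om, Finset.mul_sum]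
    refine Finset.sum_congr rfl fun k _ => ?_
    split_ifs <;> ring
  have h3 : ∑ i : Fin d, (if i ≠ a then ((α i / α a : ℝ) : ℂ) else 0)
      = (∑ i, (α i : ℂ)) / α a - 1 := by
    have ha : (α a : ℂ) ≠ 0 := by exact_mod_cast (hpos a).ne'
    have : ∀ i, (if i ≠ a then ((α i / α a : ℝ) : ℂ) else 0)
        = (α i : ℂ) / α a - if i = a then 1 else 0 := by
      intro i
      by_cases h : i = a
      · subst h; simp [ha]
      · simp [h]
    simp only [this, Finset.sum_sub_distrib, Finset.sum_div]
    simp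
  rw [h1]
  simp only [mul_sub, mul_one, Finset.sum_sub_distrib, mul_ite, mul_zero, Finset.sum_ite_eq',
    Finset.mem_univ, if_true, Finset.sum_ite_eq]
  rw [← Finset.sum_mul, h3]
  have h4 : (gam d α : ℂ) / d * (∑ i : Fin d, ∑ j : Fin d,
      if i ≠ j then ((α i / α j : ℝ) : ℂ) else 0) = 1 := by
    rw [div_mul_eq_mul_div, hgS, div_self hd0]
  linear_combination h4 - ((gam d α : ℂ) * ((∑ i, (α i : ℂ)) / α a - 1)) * (mul_inv_cancel₀ hd0)

/-- a unit vector `ψ ∈ ℂ^d ⊗ ℂ^d ⊗ ℂ^m` satisfying the two stabilizer relations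
factorizes as `|ψ(α)⟩ ⊗ ξ` for some unit vector `ξ ∈ ℂ^m`. -/
theorem state_self_testing (d m : ℕ) [NeZero d] (hd : 2 ≤ d)
    (α : Fin d → ℝ) (hpos : ∀ i, 0 < α i) (hnorm : ∑ i, α i ^ 2 = 1)
    (ψ : (Fin d × Fin d) × Fin m → ℂ) (hψ : ∑ p, Complex.normSq (ψ p) = 1)
    (hfix0 : ((Zd d ⊗ₖ (Zd d)ᴴ) ⊗ₖ (1 : Matrix (Fin m) (Fin m) ℂ)).mulVec ψ = ψ)
    (hfix1 : ((∑ k ∈ Finset.Ico 1 d,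
        (((gam d α : ℝ) : ℂ) • ((Xd d ^ k) ⊗ₖ (Xd d ^ k))
          + delt d α k • ((Zd d ^ k) ⊗ₖ (1 : Matrix (Fin d) (Fin d) ℂ))))
        ⊗ₖ (1 : Matrix (Fin m) (Fin m) ℂ)).mulVec ψ = ψ) :
    ∃ ξ : Fin m → ℂ, (∑ e, Complex.normSq (ξ e) = 1) ∧
      ∀ (a b : Fin d) (e : Fin m),
        ψ ((a, b), e) = (if a = b then (α a : ℂ) else 0) * ξ e := by
  have hp := om_prim d
  have hd0 : d ≠ 0 := NeZero.ne d
  have hsupp : ∀ a b e, a ≠ b → ψ ((a, b), e) = 0 := by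
    intro a b e hab
    have h := congrFun hfix0 ((a, b), e)
    have hz : (Zd d ⊗ₖ (Zd d)ᴴ) ⊗ₖ (1 : Matrix (Fin m) (Fin m) ℂ)
        = Matrix.diagonal (fun p : (Fin d × Fin d) × Fin m =>
          om d ^ (p.1.1 : ℕ) * star (om d ^ (p.1.2 : ℕ)) * 1) := by
      rw [Zd, Matrix.diagonal_conjTranspose, Matrix.diagonal_kronecker_diagonal,
        ← Matrix.diagonal_one, Matrix.diagonal_kronecker_diagonal]
      rfl
    rw [hz, Matrix.mulVec_diagonal] at h
    by_contra hne
    have h1 : om d ^ (a : ℕ) * star (om d ^ (b : ℕ)) = 1 := by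
      apply mul_right_cancel₀ hne
      rw [one_mul]
      simpa using h
    have hn : ‖om d‖ = 1 := hp.norm'_eq_one hd0
    have h2 : star (om d ^ (b : ℕ)) * om d ^ (b : ℕ) = 1 := by
      rw [Complex.star_def, ← Complex.normSq_eq_conj_mul_self, Complex.normSq_eq_norm_sq, norm_pow, hn]
      simp
    have h3 : om d ^ (a : ℕ) = om d ^ (b : ℕ) := by
      linear_combination (om d ^ (b : ℕ)) * h1 - (om d ^ (a : ℕ)) * h2
    exact hab (Fin.ext (hp.pow_inj a.2 b.2 h3))
  have hg : (gam d α : ℂ) ≠ 0 := by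
    have : 0 < gam d α := div_pos (by exact_mod_cast Nat.pos_of_ne_zero hd0) (S_pos d hd α hpos)
    exact_mod_cast this.ne'
  have hA : (∑ i, (α i : ℂ)) ≠ 0 := by
    have : 0 < ∑ i, α i := Finset.sum_pos (fun i _ => hpos i) ⟨⟨0, by omega⟩, Finset.mem_univ _⟩
    rw [← Complex.ofReal_sum]
    exact_mod_cast this.ne'
  have key : ∀ a e, ψ ((a, a), e) = α a * ((∑ c, ψ ((c, c), e)) / ∑ i, (α i : ℂ)) := by
    intro a e
    have ha : (α a : ℂ) ≠ 0 := by exact_mod_cast (hpos a).ne'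
    have h := congrFun hfix1 ((a, a), e)
    have hentry : ∀ c, (∑ k ∈ Finset.Ico 1 d,
        (((gam d α : ℝ) : ℂ) • ((Xd d ^ k) ⊗ₖ (Xd d ^ k))
          + delt d α k • ((Zd d ^ k) ⊗ₖ (1 : Matrix (Fin d) (Fin d) ℂ)))) (a, a) (c, c)
        = (gam d α : ℂ) * (if a = c then 0 else 1)
          + if a = c then 1 - (gam d α : ℂ) * ((∑ i, (α i : ℂ)) / α a - 1) else 0 := by
      intro c
      rw [← sum_delt d hd α hpos a, ← sum_X, Finset.mul_sum]
      simp only [Matrix.sum_apply, Matrix.add_apply, Matrix.smul_apply, smul_eq_mul,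
        Matrix.kroneckerMap_apply, Finset.sum_add_distrib, Zd, Matrix.diagonal_pow,
        Matrix.diagonal_apply, Matrix.one_apply, Pi.pow_apply]
      congr 1
      split_ifs
      · refine Finset.sum_congr rfl fun k _ => ?_
        rw [mul_one, ← pow_mul, mul_comm k]
      · simp
    generalize (∑ k ∈ Finset.Ico 1 d,
        (((gam d α : ℝ) : ℂ) • ((Xd d ^ k) ⊗ₖ (Xd d ^ k))
          + delt d α k • ((Zd d ^ k) ⊗ₖ (1 : Matrix (Fin d) (Fin d) ℂ)))) = M at h hentry
    have h5 : ∑ c, M (a, a) (c, c) * ψ ((c, c), e) = ψ ((a, a), e) := by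
      rw [← h]
      simp only [Matrix.mulVec, dotProduct, Fintype.sum_prod_type, Matrix.kroneckerMap_apply,
        Matrix.one_apply]
      refine Finset.sum_congr rfl fun c _ => ?_
      rw [Finset.sum_eq_single c]
      · simp
      · intro b _ hb
        simp [hsupp c b _ (Ne.symm hb)]
      · simp
    have h6 : ∀ c, M (a, a) (c, c) * ψ ((c, c), e) = (gam d α : ℂ) * ψ ((c, c), e)
        + if a = c then (1 - (gam d α : ℂ) * ((∑ i, (α i : ℂ)) / α a)) * ψ ((c, c), e) else 0 := by
      intro c
      rw [hentry]
      split_ifs <;> ring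
    simp only [h6, Finset.sum_add_distrib, ← Finset.mul_sum, Finset.sum_ite_eq,
      Finset.mem_univ, if_true] at h5
    have h7 : ∑ c, ψ ((c, c), e) = (∑ i, (α i : ℂ)) / α a * ψ ((a, a), e) := by
      apply mul_left_cancel₀ hg
      linear_combination h5
    rw [h7]
    field_simp
  have hall : ∀ (a b : Fin d) (e : Fin m), ψ ((a, b), e)
      = (if a = b then (α a : ℂ) else 0) * ((∑ c, ψ ((c, c), e)) / ∑ i, (α i : ℂ)) := by
    intro a b e
    split_ifs with h
    · subst h; exact key a e
    · rw [hsupp a b e h, zero_mul]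
  obtain ⟨ξ, hall⟩ : ∃ ξ : Fin m → ℂ, ∀ (a b : Fin d) (e : Fin m), ψ ((a, b), e)
      = (if a = b then (α a : ℂ) else 0) * ξ e := ⟨_, hall⟩
  refine ⟨ξ, ?_, hall⟩
  have hall' : ∀ (a b : Fin d) (e : Fin m), Complex.normSq (ψ ((a, b), e))
      = if a = b then α a ^ 2 * Complex.normSq (ξ e) else 0 := by
    intro a b e
    rw [hall a b e]
    split_ifs <;> simp [pow_two]
  rw [← hψ]
  simp only [Fintype.sum_prod_type, hall']
  have : ∀ a : Fin d, ∑ b : Fin d, ∑ e : Fin m,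
      (if a = b then α a ^ 2 * Complex.normSq (ξ e) else 0)
      = α a ^ 2 * ∑ e, Complex.normSq (ξ e) := by
    intro a
    rw [Finset.sum_comm, Finset.mul_sum]
    simp
  simp only [this, ← Finset.sum_mul, hnorm, one_mul]
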